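/- Let X be a real-valued random variable with E|X| < \infty and let X, X', X'' be i.i.d. with order statistics X_{1:3} \le X_{2:3} \le X_{3:3}. Then V^2(X) = \Delta^2(X) - (4/3) E[(X_{2:3} - X_{1:3})(X_{3:3} - X_{2:3})] and equivalently V^2(X) = \Delta^2(X) - 8 E[(X - X')_+ (X'' - X)_+], where t_+ = max(t, 0). -/

import Mathlib

open MeasureTheory

/-- The characteristic function of a law `μ` on `ℝ`. -/
noncomputable def charF (μ : Measure ℝ) (t : ℝ) : ℂ :=
  ∫ x, Complex.exp ((t * x : ℝ) * Complex.I) ∂μ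

/-- The distance variance of a real random variable with law `μ`, defined via the
characteristic-function integral `V²(X) = π⁻² ∬ |f(s+t) - f(s)f(t)|² / (s²t²) ds dt`. -/
noncomputable def distVar (μ : Measure ℝ) : ℝ :=
  (1 / Real.pi ^ 2) *
    ∫ q : ℝ × ℝ, ‖charF μ (q.1 + q.2) - charF μ q.1 * charF μ q.2‖ ^ 2 / (q.1 ^ 2 * q.2 ^ 2)

theorem int_fun_sub {α E : Type*} [MeasurableSpace α] [NormedAddCommGroup E] {P : Measure α}
    {f g : α → E} (hf : Integrable f P) (hg : Integrable g P) :
    Integrable (fun x => f x - g x) P := hf.sub hg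

theorem cosk_integrable : Integrable (fun s : ℝ => (1 - Real.cos s) / s ^ 2) := by
  refine Integrable.mono' ((integrable_inv_one_add_sq).const_mul (5/2)) ?_ ?_
  · exact (Measurable.aestronglyMeasurable (by fun_prop))
  · refine Filter.Eventually.of_forall fun s => ?_
    have h1 := Real.one_sub_sq_div_two_le_cos (x := s)
    have h2 := Real.neg_one_le_cos s
    have h3 := Real.cos_le_one s
    rcases eq_or_ne s 0 with rfl | hs
    · norm_num
    have : 0 < s ^ 2 := by positivity
    rw [Real.norm_of_nonneg (by apply div_nonneg <;> linarith), div_le_iff₀ this,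
      ← div_eq_mul_inv, div_mul_eq_mul_div, le_div_iff₀ (by positivity)]
    nlinarith

theorem lap1 (t : ℝ) (ht : 0 < t) :
    IntegrableOn (fun s : ℝ => (1 - Real.cos s) * (t * Real.exp (-t * s))) (Set.Ioi 0) ∧
    ∫ s in Set.Ioi (0:ℝ), (1 - Real.cos s) * (t * Real.exp (-t * s)) = (1 + t ^ 2)⁻¹ := by
  have ha : ((-t : ℂ)).re < 0 := by simpa
  have hb : ((-t + Complex.I : ℂ)).re < 0 := by simpa
  have i1 := (integrableOn_exp_mul_complex_Ioi ha 0).const_mul (t : ℂ)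
  have i2 := (integrableOn_exp_mul_complex_Ioi hb 0).const_mul (t : ℂ)
  have e1 := integral_exp_mul_complex_Ioi ha 0
  have e2 := integral_exp_mul_complex_Ioi hb 0
  have key : (fun s : ℝ => (1 - Real.cos s) * (t * Real.exp (-t * s))) =
      fun s : ℝ => ((t : ℂ) * Complex.exp (-t * s) - t * Complex.exp ((-t + Complex.I) * s)).re := by
    funext s
    simp [Complex.exp_re]
    ring
  rw [key]
  have i3 := i1.sub i2
  refine ⟨i3.re, ?_⟩
  have := integral_re i3
  simp only [RCLike.re_eq_complex_re, Pi.sub_apply] at this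
  rw [this, integral_sub i1 i2, integral_const_mul, integral_const_mul, e1, e2]
  have hne : (-t + Complex.I : ℂ) ≠ 0 := by
    intro h; rw [h] at hb; simp at hb
  have : ((-1 : ℂ) / (-t + Complex.I)) = (t + Complex.I) / (1 + t ^ 2) := by
    have h2 : (1 + t ^ 2 : ℂ) ≠ 0 := by
      norm_cast; positivity
    rw [div_eq_div_iff hne h2]
    linear_combination (-1:ℂ) * Complex.I_sq
  have hs : ((1 : ℂ) + t ^ 2) = ((1 + t ^ 2 : ℝ) : ℂ) := by push_cast; rfl
  simp only [Complex.ofReal_zero, mul_zero, Complex.exp_zero]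
  rw [this, hs]
  have ht' : (t : ℂ) ≠ 0 := by exact_mod_cast ht.ne'
  have : (t : ℂ) * (-1 / -t) = 1 := by field_simp
  rw [this]
  simp only [Complex.sub_re, Complex.one_re, Complex.re_ofReal_mul, Complex.div_ofReal_re, Complex.add_re, Complex.ofReal_re, Complex.I_re]
  field_simp
  ring

theorem lap2 (s : ℝ) (hs : 0 < s) :
    ∫ t in Set.Ioi (0:ℝ), (1 - Real.cos s) * (t * Real.exp (-t * s)) = (1 - Real.cos s) / s ^ 2 := by
  have := Real.integral_rpow_mul_exp_neg_mul_Ioi (a := 2) (r := s) (by norm_num) hs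
  rw [integral_const_mul]
  norm_num at this
  have h2 : (fun t : ℝ => t * Real.exp (-t * s)) = fun t => t * Real.exp (-(s*t)) := by
    funext t; congr 2; ring
  simp only [neg_mul] at *
  simp_rw [mul_comm _ s]
  rw [this]; rfl

theorem cosk_Ioi : ∫ s in Set.Ioi (0:ℝ), (1 - Real.cos s) / s ^ 2 = Real.pi / 2 := by
  have hI : Integrable (Function.uncurry fun t s : ℝ => (1 - Real.cos s) * (t * Real.exp (-t * s)))
      ((volume.restrict (Set.Ioi 0)).prod (volume.restrict (Set.Ioi 0))) := by
    rw [integrable_prod_iff (Measurable.aestronglyMeasurable (by unfold Function.uncurry; fun_prop))]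
    constructor
    · filter_upwards [ae_restrict_mem measurableSet_Ioi] with t ht
      exact (lap1 t ht).1
    · refine (integrable_inv_one_add_sq.integrableOn (s := Set.Ioi 0)).congr ?_
      filter_upwards [ae_restrict_mem measurableSet_Ioi] with t ht
      rw [← (lap1 t ht).2]
      refine integral_congr_ae (Filter.Eventually.of_forall fun s => ?_)
      have : 0 < t := ht
      have h3 := Real.cos_le_one s
      simp only [Function.uncurry]
      rw [Real.norm_of_nonneg]
      have : 0 ≤ 1 - Real.cos s := by linarith
      positivity
  have sw := integral_integral_swap hI
  rw [setIntegral_congr_fun measurableSet_Ioi (fun t ht => (lap1 t ht).2),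
    setIntegral_congr_fun measurableSet_Ioi (fun s hs => lap2 s hs)] at sw
  rw [← sw, integral_Ioi_inv_one_add_sq]
  simp

theorem cosk_total (x : ℝ) : Integrable (fun s : ℝ => (1 - Real.cos (s * x)) / s ^ 2) ∧
    ∫ s : ℝ, (1 - Real.cos (s * x)) / s ^ 2 = Real.pi * |x| := by
  have h0 : ∫ s : ℝ, (1 - Real.cos s) / s ^ 2 = Real.pi := by
    have := integral_comp_abs (f := fun s : ℝ => (1 - Real.cos s) / s ^ 2)
    simp only [Real.cos_abs, sq_abs] at this
    rw [this, cosk_Ioi]; ring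
  rcases eq_or_ne x 0 with rfl | hx
  · simp
  have e : (fun s : ℝ => (1 - Real.cos (s * x)) / s ^ 2) =
      fun s => x ^ 2 * ((1 - Real.cos (s * x)) / (s * x) ^ 2) := by
    funext s; rcases eq_or_ne s 0 with rfl | hs
    · simp
    field_simp
  rw [e]
  refine ⟨(cosk_integrable.comp_mul_right' hx).const_mul _, ?_⟩
  rw [integral_const_mul, Measure.integral_comp_mul_right (fun s : ℝ => (1 - Real.cos s) / s ^ 2) x, h0]
  rw [abs_inv, smul_eq_mul, ← sq_abs x]
  have := abs_pos.2 hx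
  field_simp

noncomputable def ee (s x : ℝ) : ℂ := Complex.exp ((s * x : ℝ) * Complex.I)

theorem ee_meas : Measurable (fun q : ℝ × ℝ => ee q.1 q.2) := by
  unfold ee; fun_prop

theorem ee_norm (s x : ℝ) : ‖ee s x‖ = 1 := Complex.norm_exp_ofReal_mul_I _

theorem ee_mul (s t x : ℝ) : ee (s + t) x = ee s x * ee t x := by
  unfold ee; rw [← Complex.exp_add]; congr 1; push_cast; ring

theorem ee_re (s x : ℝ) : (ee s x).re = Real.cos (s * x) := Complex.exp_ofReal_mul_I_re _
theorem ee_im (s x : ℝ) : (ee s x).im = Real.sin (s * x) := Complex.exp_ofReal_mul_I_im _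

noncomputable def ph (s : ℝ) (p : ℝ × ℝ) : ℂ := ee s p.1 - ee s p.2

theorem ph_meas : Measurable (fun q : ℝ × ℝ × ℝ => ph q.1 q.2) := by
  unfold ph ee; fun_prop

theorem ph_norm_sq (s : ℝ) (p : ℝ × ℝ) :
    ‖ph s p‖ ^ 2 = 2 * (1 - Real.cos (s * (p.1 - p.2))) := by
  rw [Complex.sq_norm, Complex.normSq_apply]
  simp only [ph, Complex.sub_re, Complex.sub_im, ee_re, ee_im, mul_sub, Real.cos_sub]
  linear_combination Real.sin_sq_add_cos_sq (s * p.1) + Real.sin_sq_add_cos_sq (s * p.2)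

noncomputable def kk (s : ℝ) (p : ℝ × ℝ) : ℝ := ‖ph s p‖ ^ 2 / s ^ 2

theorem kk_meas : Measurable (fun q : ℝ × ℝ × ℝ => kk q.1 q.2) := by
  have := ph_meas
  unfold kk; fun_prop

theorem kk_nonneg (s : ℝ) (p : ℝ × ℝ) : 0 ≤ kk s p := by unfold kk; positivity

theorem kk_int (p : ℝ × ℝ) : Integrable (fun s => kk s p) ∧
    ∫ s, kk s p = 2 * Real.pi * |p.1 - p.2| := by
  have h := cosk_total (p.1 - p.2)
  have e : (fun s => kk s p) = fun s => 2 * ((1 - Real.cos (s * (p.1 - p.2))) / s ^ 2) := by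
    funext s; unfold kk; rw [ph_norm_sq]; ring
  rw [e]
  refine ⟨h.1.const_mul _, ?_⟩
  rw [integral_const_mul, h.2]; ring

noncomputable def gg (s : ℝ) (p r : ℝ × ℝ) : ℂ := ph s p * star (ph s r) / (s : ℂ) ^ 2

noncomputable def DD (p r : ℝ × ℝ) : ℝ :=
  |p.1 - r.2| + |p.2 - r.1| - |p.1 - r.1| - |p.2 - r.2|

theorem gg_meas : Measurable (fun q : ℝ × (ℝ × ℝ) × (ℝ × ℝ) => gg q.1 q.2.1 q.2.2) := by
  have h1 : Measurable (fun q : ℝ × (ℝ × ℝ) × (ℝ × ℝ) => ph q.1 q.2.1) :=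
    ph_meas.comp (f := fun q : ℝ × (ℝ × ℝ) × (ℝ × ℝ) => (q.1, q.2.1)) (by fun_prop)
  have h2 : Measurable (fun q : ℝ × (ℝ × ℝ) × (ℝ × ℝ) => ph q.1 q.2.2) :=
    ph_meas.comp (f := fun q : ℝ × (ℝ × ℝ) × (ℝ × ℝ) => (q.1, q.2.2)) (by fun_prop)
  unfold gg
  have h3 : Measurable (fun q : ℝ × (ℝ × ℝ) × (ℝ × ℝ) => star (ph q.1 q.2.2)) :=
    continuous_star.measurable.comp h2
  fun_prop

theorem gg_norm (s : ℝ) (p r : ℝ × ℝ) : ‖gg s p r‖ = ‖ph s p‖ * ‖ph s r‖ / s ^ 2 := by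
  unfold gg; simp

theorem gg_int (p r : ℝ × ℝ) : Integrable (fun s => gg s p r) := by
  refine Integrable.mono' ((kk_int p).1.add (kk_int r).1) ?_ ?_
  · exact (gg_meas.comp (f := fun s : ℝ => (s, p, r)) (by fun_prop)).aestronglyMeasurable
  · refine Filter.Eventually.of_forall fun s => ?_
    rw [gg_norm]
    simp only [kk, Pi.add_apply, ← add_div]
    gcongr
    nlinarith [sq_nonneg (‖ph s p‖ - ‖ph s r‖), sq_nonneg (‖ph s p‖ + ‖ph s r‖)]

theorem gg_integral (p r : ℝ × ℝ) : ∫ s, gg s p r = ((Real.pi * DD p r : ℝ) : ℂ) := by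
  have hi := gg_int p r
  have hre : ∀ s, (gg s p r).re = (1 - Real.cos (s * (p.1 - r.2))) / s ^ 2
      + (1 - Real.cos (s * (p.2 - r.1))) / s ^ 2 - (1 - Real.cos (s * (p.1 - r.1))) / s ^ 2
      - (1 - Real.cos (s * (p.2 - r.2))) / s ^ 2 := by
    intro s
    have : (s : ℂ) ^ 2 = ((s ^ 2 : ℝ) : ℂ) := by push_cast; rfl
    rw [gg, this, Complex.div_ofReal_re]
    simp only [ph, Complex.mul_re, Complex.star_def, Complex.conj_re, Complex.conj_im, Complex.sub_re, Complex.sub_im, ee_re, ee_im, mul_sub, Real.cos_sub]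
    ring
  have him : ∀ s, (gg (-s) p r).im = -(gg s p r).im := by
    intro s
    have (s : ℝ) : (s : ℂ) ^ 2 = ((s ^ 2 : ℝ) : ℂ) := by push_cast; rfl
    rw [gg, gg, this, this, Complex.div_ofReal_im, Complex.div_ofReal_im]
    simp only [ph, Complex.mul_im, Complex.star_def, Complex.conj_re, Complex.conj_im, Complex.sub_re, Complex.sub_im, ee_re, ee_im, neg_mul, Real.sin_neg, Real.cos_neg]
    ring
  apply Complex.ext
  · have := integral_re hi
    simp only [RCLike.re_eq_complex_re] at this
    rw [← this, Complex.ofReal_re]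
    simp_rw [hre]
    have c1 := cosk_total (p.1 - r.2)
    have c2 := cosk_total (p.2 - r.1)
    have c3 := cosk_total (p.1 - r.1)
    have c4 := cosk_total (p.2 - r.2)
    rw [integral_sub (int_fun_sub (c1.1.fun_add c2.1) c3.1) c4.1, integral_sub (c1.1.fun_add c2.1) c3.1,
      integral_add c1.1 c2.1, c1.2, c2.2, c3.2, c4.2, DD]
    ring
  · have := integral_im hi
    simp only [RCLike.im_eq_complex_im] at this
    rw [← this, Complex.ofReal_im]
    have h2 := integral_neg_eq_self (fun s => (gg s p r).im) (volume : Measure ℝ)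
    simp_rw [him, integral_neg] at h2
    linarith

theorem ee_integrable (μ : Measure ℝ) [IsProbabilityMeasure μ] (s : ℝ) :
    Integrable (fun x => ee s x) μ := by
  refine (integrable_const (1 : ℝ)).mono' ?_ ?_
  · exact (ee_meas.comp (f := fun x : ℝ => (s, x)) (by fun_prop)).aestronglyMeasurable
  · exact Filter.Eventually.of_forall fun x => (ee_norm s x).le

theorem cov_eq (μ : Measure ℝ) [IsProbabilityMeasure μ] (s t : ℝ) :
    charF μ (s + t) - charF μ s * charF μ t = (1 / 2) * ∫ p, ph s p * ph t p ∂(μ.prod μ) := by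
  have e1 : ∀ u, charF μ u = ∫ x, ee u x ∂μ := fun u => rfl
  have hc : Integrable (fun _ : ℝ => (1 : ℂ)) μ := integrable_const _
  have ex : ∀ p : ℝ × ℝ, ph s p * ph t p = ee (s + t) p.1 * 1 + 1 * ee (s + t) p.2
      - ee s p.1 * ee t p.2 - ee t p.1 * ee s p.2 := by
    intro p; rw [ee_mul, ee_mul, ph, ph]; ring
  simp_rw [ex]
  have hst := ee_integrable μ (s + t)
  have hs := ee_integrable μ s
  have ht := ee_integrable μ t
  have a1 := hst.mul_prod hc
  have a2 := hc.mul_prod hst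
  have a3 := hs.mul_prod ht
  have a4 := ht.mul_prod hs
  rw [integral_sub (int_fun_sub (a1.fun_add a2) a3) a4, integral_sub (a1.fun_add a2) a3, integral_add a1 a2,
    integral_prod_mul (fun x => ee (s + t) x) (fun _ => (1:ℂ)),
    integral_prod_mul (fun _ => (1:ℂ)) (fun x => ee (s + t) x),
    integral_prod_mul (fun x => ee s x) (fun x => ee t x),
    integral_prod_mul (fun x => ee t x) (fun x => ee s x), e1, e1, e1]
  simp
  ring

noncomputable def GG (q : ℝ × ℝ) (w : (ℝ × ℝ) × (ℝ × ℝ)) : ℂ := gg q.1 w.1 w.2 * gg q.2 w.1 w.2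

theorem integrand_eq (μ : Measure ℝ) [IsProbabilityMeasure μ] (q : ℝ × ℝ) :
    ((‖charF μ (q.1 + q.2) - charF μ q.1 * charF μ q.2‖ ^ 2 / (q.1 ^ 2 * q.2 ^ 2) : ℝ) : ℂ)
      = (1 / 4) * ∫ w, GG q w ∂((μ.prod μ).prod (μ.prod μ)) := by
  have e : ∀ w : (ℝ × ℝ) × (ℝ × ℝ), GG q w = ((ph q.1 w.1 * ph q.2 w.1)
      * star (ph q.1 w.2 * ph q.2 w.2)) * (1 / ((q.1 : ℂ) ^ 2 * (q.2 : ℂ) ^ 2)) := by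
    intro w; simp only [GG, gg, star_mul]; ring
  simp_rw [e]
  rw [integral_mul_const, integral_prod_mul (fun p => ph q.1 p * ph q.2 p)
    (fun p => star (ph q.1 p * ph q.2 p)), cov_eq]
  have : ∫ p, star (ph q.1 p * ph q.2 p) ∂(μ.prod μ) = star (∫ p, ph q.1 p * ph q.2 p ∂(μ.prod μ)) :=
    integral_conj
  rw [this]
  push_cast
  rw [← Complex.mul_conj', map_mul]
  have h2 : (starRingEnd ℂ) (1 / 2) = 1 / 2 := by
    rw [map_div₀, map_one, Complex.conj_ofNat]
  rw [h2, ← starRingEnd_apply]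
  ring

theorem diff_int (μ : Measure ℝ) [IsProbabilityMeasure μ]
    (h1 : Integrable (fun x => |x|) μ) :
    Integrable (fun q : ℝ × ℝ => |q.1 - q.2|) (μ.prod μ) := by
  have h : Integrable (fun x : ℝ => x) μ :=
    (integrable_norm_iff (by fun_prop)).1 h1
  have a := h.comp_fst μ
  have b := h.comp_snd μ
  exact (a.sub b).abs

theorem kk_dom (μ : Measure ℝ) [IsProbabilityMeasure μ] (h1 : Integrable (fun x => |x|) μ) :
    Integrable (fun z : (ℝ × ℝ) × ((ℝ × ℝ) × (ℝ × ℝ)) => kk z.1.1 z.2.1 * kk z.1.2 z.2.2)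
      ((volume : Measure (ℝ × ℝ)).prod ((μ.prod μ).prod (μ.prod μ))) := by
  have hm : Measurable (fun z : (ℝ × ℝ) × ((ℝ × ℝ) × (ℝ × ℝ)) => kk z.1.1 z.2.1 * kk z.1.2 z.2.2) :=
    (kk_meas.comp (f := fun z : (ℝ × ℝ) × ((ℝ × ℝ) × (ℝ × ℝ)) => (z.1.1, z.2.1)) (by fun_prop)).mul
    (kk_meas.comp (f := fun z : (ℝ × ℝ) × ((ℝ × ℝ) × (ℝ × ℝ)) => (z.1.2, z.2.2)) (by fun_prop))
  rw [integrable_prod_iff' hm.aestronglyMeasurable]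
  constructor
  · refine Filter.Eventually.of_forall fun w => ?_
    exact (kk_int w.1).1.mul_prod (kk_int w.2).1
  · have hd := ((diff_int μ h1).const_mul (2 * Real.pi)).mul_prod
      ((diff_int μ h1).const_mul (2 * Real.pi))
    refine hd.congr (Filter.Eventually.of_forall fun w => ?_)
    simp only
    rw [← (kk_int w.1).2, ← (kk_int w.2).2, ← integral_prod_mul]
    refine integral_congr_ae (Filter.Eventually.of_forall fun q => ?_)
    exact (Real.norm_of_nonneg (mul_nonneg (kk_nonneg _ _) (kk_nonneg _ _))).symm

theorem kk_dom' (μ : Measure ℝ) [IsProbabilityMeasure μ] (h1 : Integrable (fun x => |x|) μ) :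
    Integrable (fun z : (ℝ × ℝ) × ((ℝ × ℝ) × (ℝ × ℝ)) => kk z.1.2 z.2.1 * kk z.1.1 z.2.2)
      ((volume : Measure (ℝ × ℝ)).prod ((μ.prod μ).prod (μ.prod μ))) := by
  have mp : MeasurePreserving (Prod.map Prod.swap id : (ℝ × ℝ) × ((ℝ × ℝ) × (ℝ × ℝ)) → _)
      ((volume : Measure (ℝ × ℝ)).prod ((μ.prod μ).prod (μ.prod μ)))
      ((volume : Measure (ℝ × ℝ)).prod ((μ.prod μ).prod (μ.prod μ))) :=
    (Measure.measurePreserving_swap (μ := (volume : Measure ℝ)) (ν := (volume : Measure ℝ))).prod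
      (MeasurePreserving.id _)
  exact mp.integrable_comp_of_integrable (kk_dom μ h1)

theorem GG_int (μ : Measure ℝ) [IsProbabilityMeasure μ] (h1 : Integrable (fun x => |x|) μ) :
    Integrable (Function.uncurry GG)
      ((volume : Measure (ℝ × ℝ)).prod ((μ.prod μ).prod (μ.prod μ))) := by
  refine Integrable.mono' ((kk_dom μ h1).add (kk_dom' μ h1)) ?_ ?_
  · refine Measurable.aestronglyMeasurable ?_
    exact (gg_meas.comp (f := fun z : (ℝ × ℝ) × ((ℝ × ℝ) × (ℝ × ℝ)) => (z.1.1, z.2.1, z.2.2)) (by fun_prop)).mul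
      (gg_meas.comp (f := fun z : (ℝ × ℝ) × ((ℝ × ℝ) × (ℝ × ℝ)) => (z.1.2, z.2.1, z.2.2)) (by fun_prop))
  · refine Filter.Eventually.of_forall fun z => ?_
    simp only [Function.uncurry, GG, norm_mul, gg_norm, Pi.add_apply, kk]
    set a := ‖ph z.1.1 z.2.1‖
    set b := ‖ph z.1.1 z.2.2‖
    set c := ‖ph z.1.2 z.2.1‖
    set d := ‖ph z.1.2 z.2.2‖
    have e1 : a * b / z.1.1 ^ 2 * (c * d / z.1.2 ^ 2) = (a * d) * (c * b) / (z.1.1 ^ 2 * z.1.2 ^ 2) := by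
      ring
    have e2 : a ^ 2 / z.1.1 ^ 2 * (d ^ 2 / z.1.2 ^ 2) + c ^ 2 / z.1.2 ^ 2 * (b ^ 2 / z.1.1 ^ 2)
        = ((a * d) ^ 2 + (c * b) ^ 2) / (z.1.1 ^ 2 * z.1.2 ^ 2) := by ring
    rw [e1, e2]
    gcongr
    nlinarith [sq_nonneg (a * d - c * b), sq_nonneg (a * d + c * b)]

theorem distVar_DD (μ : Measure ℝ) [IsProbabilityMeasure μ] (h1 : Integrable (fun x => |x|) μ) :
    Integrable (fun w => DD w.1 w.2 ^ 2) ((μ.prod μ).prod (μ.prod μ)) ∧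
    distVar μ = (1 / 4) * ∫ w, DD w.1 w.2 ^ 2 ∂((μ.prod μ).prod (μ.prod μ)) := by
  have hG := GG_int μ h1
  have inner : ∀ w : (ℝ × ℝ) × (ℝ × ℝ), ∫ q, GG q w = ((Real.pi ^ 2 * DD w.1 w.2 ^ 2 : ℝ) : ℂ) := by
    intro w
    have := integral_prod_mul (μ := (volume : Measure ℝ)) (ν := (volume : Measure ℝ))
      (fun s => gg s w.1 w.2) (fun s => gg s w.1 w.2)
    rw [gg_integral] at this
    refine this.trans ?_
    push_cast; ring
  have hp : Real.pi ^ 2 ≠ 0 := by positivity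
  constructor
  · have := hG.integral_prod_right
    simp only [Function.uncurry] at this
    simp_rw [inner] at this
    have h3 := (this.re).const_mul ((Real.pi ^ 2)⁻¹)
    refine h3.congr (Filter.Eventually.of_forall fun w => ?_)
    simp only [RCLike.re_eq_complex_re, Complex.ofReal_re]
    field_simp
  · have sw := integral_integral_swap hG
    simp_rw [inner] at sw
    have : ((∫ q : ℝ × ℝ, ‖charF μ (q.1 + q.2) - charF μ q.1 * charF μ q.2‖ ^ 2 / (q.1 ^ 2 * q.2 ^ 2) : ℝ) : ℂ)
        = ((1 / 4 * (Real.pi ^ 2 * ∫ w, DD w.1 w.2 ^ 2 ∂((μ.prod μ).prod (μ.prod μ))) : ℝ) : ℂ) := by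
      rw [← integral_complex_ofReal]
      simp_rw [integrand_eq]
      rw [integral_const_mul, sw, integral_complex_ofReal, integral_const_mul]
      push_cast; ring
    have := Complex.ofReal_injective this
    rw [distVar, this]
    field_simp

noncomputable def MM (x y z : ℝ) : ℝ := max (x - y) 0 * max (z - x) 0

noncomputable def TT (x y z : ℝ) : ℝ :=
  ((x + y + z - min x (min y z) - max x (max y z)) - min x (min y z)) *
    (max x (max y z) - (x + y + z - min x (min y z) - max x (max y z)))

theorem TT_12 (x y z : ℝ) : TT x y z = TT y x z := by
  unfold TT; rw [min_left_comm x y z, max_left_comm x y z]; ring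

theorem TT_23 (x y z : ℝ) : TT x y z = TT x z y := by
  unfold TT; rw [min_comm y z, max_comm y z]; ring

theorem TT_sorted (x y z : ℝ) (h : x ≤ y) (h' : y ≤ z) : TT x y z = (y - x) * (z - y) := by
  unfold TT
  rw [min_eq_left h', max_eq_right h', min_eq_left h, max_eq_right (h.trans h')]; ring

def TMrel (x y z : ℝ) : Prop :=
  TT x y z = MM x y z + MM x z y + MM y x z + MM y z x + MM z x y + MM z y x

theorem TM_12 {x y z : ℝ} (h : TMrel y x z) : TMrel x y z := by
  unfold TMrel at *; rw [TT_12, h]; ring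

theorem TM_23 {x y z : ℝ} (h : TMrel x z y) : TMrel x y z := by
  unfold TMrel at *; rw [TT_23, h]; ring

theorem TM_sorted {x y z : ℝ} (h : x ≤ y) (h' : y ≤ z) : TMrel x y z := by
  unfold TMrel MM
  have h'' := h.trans h'
  rw [TT_sorted x y z h h', max_eq_right (sub_nonpos.2 h), max_eq_right (sub_nonpos.2 h'),
    max_eq_right (sub_nonpos.2 h''), max_eq_left (sub_nonneg.2 h), max_eq_left (sub_nonneg.2 h'),
    max_eq_left (sub_nonneg.2 h'')]
  ring

theorem TM_2 {x y z : ℝ} (h : x ≤ y) : TMrel x y z := by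
  rcases le_total y z with h1 | h1
  · exact TM_sorted h h1
  rcases le_total x z with h2 | h2
  · exact TM_23 (TM_sorted h2 h1)
  · exact TM_23 (TM_12 (TM_sorted h2 h))

theorem TM_all (x y z : ℝ) : TMrel x y z := by
  rcases le_total x y with h | h
  · exact TM_2 h
  · exact TM_12 (TM_2 h)

def Phi (a b c d : ℝ) : Prop :=
  (DD (a, b) (c, d) ^ 2 + DD (a, c) (b, d) ^ 2 + DD (a, d) (b, c) ^ 2) / 4 =
    |a - b| * |c - d| + |a - c| * |b - d| + |a - d| * |b - c|
      - (TT a b c + TT a b d + TT a c d + TT b c d)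

theorem Phi_12 {a b c d : ℝ} (h : Phi b a c d) : Phi a b c d := by
  unfold Phi DD at *
  rw [TT_12 b a c, TT_12 b a d] at h
  simp only [abs_sub_comm b a, abs_sub_comm c a, abs_sub_comm d a, abs_sub_comm c b,
    abs_sub_comm d b, abs_sub_comm d c] at *
  linear_combination h

theorem Phi_23 {a b c d : ℝ} (h : Phi a c b d) : Phi a b c d := by
  unfold Phi DD at *
  rw [TT_23 a c b, TT_12 c b d] at h
  simp only [abs_sub_comm b a, abs_sub_comm c a, abs_sub_comm d a, abs_sub_comm c b,
    abs_sub_comm d b, abs_sub_comm d c] at *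
  linear_combination h

theorem Phi_34 {a b c d : ℝ} (h : Phi a b d c) : Phi a b c d := by
  unfold Phi DD at *
  rw [TT_23 a d c, TT_23 b d c] at h
  simp only [abs_sub_comm b a, abs_sub_comm c a, abs_sub_comm d a, abs_sub_comm c b,
    abs_sub_comm d b, abs_sub_comm d c] at *
  linear_combination h

theorem Phi_sorted {a b c d : ℝ} (h1 : a ≤ b) (h2 : b ≤ c) (h3 : c ≤ d) : Phi a b c d := by
  have h12 := h1.trans h2
  have h23 := h2.trans h3
  have h13 := h12.trans h3
  unfold Phi DD
  rw [TT_sorted a b c h1 h2, TT_sorted a b d h1 h23, TT_sorted a c d h12 h3, TT_sorted b c d h2 h3]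
  simp only [abs_sub_comm b a, abs_sub_comm c a, abs_sub_comm d a, abs_sub_comm c b,
    abs_sub_comm d b, abs_sub_comm d c]
  rw [abs_of_nonpos (sub_nonpos.2 h1), abs_of_nonpos (sub_nonpos.2 h2),
    abs_of_nonpos (sub_nonpos.2 h3), abs_of_nonpos (sub_nonpos.2 h12),
    abs_of_nonpos (sub_nonpos.2 h23), abs_of_nonpos (sub_nonpos.2 h13)]
  ring

theorem Phi_3 {a b c d : ℝ} (h1 : a ≤ b) (h2 : b ≤ c) : Phi a b c d := by
  rcases le_total c d with h3 | h3
  · exact Phi_sorted h1 h2 h3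
  rcases le_total b d with h4 | h4
  · exact Phi_34 (Phi_sorted h1 h4 h3)
  rcases le_total a d with h5 | h5
  · exact Phi_34 (Phi_23 (Phi_sorted h5 h4 h2))
  · exact Phi_34 (Phi_23 (Phi_12 (Phi_sorted h5 h1 h2)))

theorem Phi_2 {a b c d : ℝ} (h1 : a ≤ b) : Phi a b c d := by
  rcases le_total b c with h3 | h3
  · exact Phi_3 h1 h3
  rcases le_total a c with h4 | h4
  · exact Phi_23 (Phi_3 h4 h3)
  · exact Phi_23 (Phi_12 (Phi_3 h4 h1))

theorem Phi_all (a b c d : ℝ) : Phi a b c d := by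
  rcases le_total a b with h | h
  · exact Phi_2 h
  · exact Phi_12 (Phi_2 h)

theorem MM_bound (x y z : ℝ) : ‖MM x y z‖ ≤ |x| * |z| + |y| * |z| + |x| * |y| := by
  have hx := abs_nonneg x
  have hy := abs_nonneg y
  have hz := abs_nonneg z
  unfold MM
  rw [Real.norm_of_nonneg (by positivity)]
  rcases le_total 0 x with h | h
  · have e1 : max (z - x) 0 ≤ |z| := max_le (by linarith [le_abs_self z]) hz
    have e2 : max (x - y) 0 ≤ |x| + |y| :=
      max_le (by linarith [le_abs_self x, neg_abs_le y]) (by positivity)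
    have := mul_le_mul e2 e1 (le_max_right _ _) (by positivity)
    nlinarith [mul_nonneg hx hy]
  · have e1 : max (x - y) 0 ≤ |y| := max_le (by linarith [neg_abs_le y]) hy
    have e2 : max (z - x) 0 ≤ |x| + |z| :=
      max_le (by linarith [le_abs_self z, neg_abs_le x]) (by positivity)
    have := mul_le_mul e1 e2 (le_max_right _ _) (by positivity)
    nlinarith [mul_nonneg hx hz]

theorem MM_int (μ : Measure ℝ) [IsProbabilityMeasure μ] (h1 : Integrable (fun x => |x|) μ) :
    Integrable (fun q : ℝ × ℝ × ℝ => MM q.1 q.2.1 q.2.2) (μ.prod (μ.prod μ)) := by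
  have b1 : Integrable (fun q : ℝ × ℝ × ℝ => |q.1| * |q.2.2|) (μ.prod (μ.prod μ)) :=
    h1.mul_prod (h1.comp_snd μ)
  have b2 : Integrable (fun q : ℝ × ℝ × ℝ => |q.2.1| * |q.2.2|) (μ.prod (μ.prod μ)) :=
    (h1.mul_prod h1).comp_snd μ
  have b3 : Integrable (fun q : ℝ × ℝ × ℝ => |q.1| * |q.2.1|) (μ.prod (μ.prod μ)) :=
    h1.mul_prod (h1.comp_fst μ)
  refine ((b1.add b2).add b3).mono' ?_ ?_
  · exact Measurable.aestronglyMeasurable (by unfold MM; fun_prop)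
  · exact Filter.Eventually.of_forall fun q => MM_bound _ _ _

section law
open ProbabilityTheory

theorem pi_indep (μ : Measure ℝ) [IsProbabilityMeasure μ] :
    iIndepFun (fun (i : Fin 4) (x : Fin 4 → ℝ) => x i) (Measure.pi fun _ : Fin 4 => μ) :=
  iIndepFun_pi (X := fun _ x => x) (fun _ => aemeasurable_id)

theorem law1 (μ : Measure ℝ) [IsProbabilityMeasure μ] (i : Fin 4) :
    Measure.map (fun x : Fin 4 → ℝ => x i) (Measure.pi fun _ : Fin 4 => μ) = μ :=
  (measurePreserving_eval (fun _ : Fin 4 => μ) i).map_eq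

theorem law2 (μ : Measure ℝ) [IsProbabilityMeasure μ] (i j : Fin 4) (h : i ≠ j) :
    MeasurePreserving (fun x : Fin 4 → ℝ => (x i, x j)) (Measure.pi fun _ : Fin 4 => μ)
      (μ.prod μ) := by
  refine ⟨by fun_prop, ?_⟩
  have := (indepFun_iff_map_prod_eq_prod_map_map (measurable_pi_apply _).aemeasurable
    (measurable_pi_apply _).aemeasurable).1
    ((pi_indep μ).indepFun h)
  rw [this, law1, law1]

theorem law3 (μ : Measure ℝ) [IsProbabilityMeasure μ] (i j k : Fin 4) (hij : i ≠ j) (hik : i ≠ k)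
    (hjk : j ≠ k) :
    MeasurePreserving (fun x : Fin 4 → ℝ => (x i, x j, x k)) (Measure.pi fun _ : Fin 4 => μ)
      (μ.prod (μ.prod μ)) := by
  refine ⟨by fun_prop, ?_⟩
  have := (indepFun_iff_map_prod_eq_prod_map_map (measurable_pi_apply _).aemeasurable
    (by fun_prop)).1
    ((pi_indep μ).indepFun_prodMk (fun i => by fun_prop) j k i hij.symm hik.symm).symm
  rw [this, law1, (law2 μ j k hjk).map_eq]

theorem law4 (μ : Measure ℝ) [IsProbabilityMeasure μ] (i j k l : Fin 4) (hij : i ≠ j)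
    (hkl : k ≠ l) (hik : i ≠ k) (hil : i ≠ l) (hjk : j ≠ k) (hjl : j ≠ l) :
    MeasurePreserving (fun x : Fin 4 → ℝ => ((x i, x j), (x k, x l)))
      (Measure.pi fun _ : Fin 4 => μ) ((μ.prod μ).prod (μ.prod μ)) := by
  refine ⟨by fun_prop, ?_⟩
  have := (indepFun_iff_map_prod_eq_prod_map_map (by fun_prop) (by fun_prop)).1
    ((pi_indep μ).indepFun_prodMk_prodMk (fun i => by fun_prop) i j k l hik hil hjk hjl)
  rw [this, (law2 μ i j hij).map_eq, (law2 μ k l hkl).map_eq]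

end law

theorem mp_int {α β : Type*} [MeasurableSpace α] [MeasurableSpace β] {P : Measure α} {Q : Measure β}
    {φ : α → β} (h : MeasurePreserving φ P Q) {g : β → ℝ} (hg : Integrable g Q) :
    Integrable (fun x => g (φ x)) P ∧ ∫ x, g (φ x) ∂P = ∫ y, g y ∂Q := by
  refine ⟨h.integrable_comp_of_integrable hg, ?_⟩
  rw [← h.map_eq, integral_map h.measurable.aemeasurable (by rw [h.map_eq]; exact hg.1)]

theorem TT_int (μ : Measure ℝ) [IsProbabilityMeasure μ] (h1 : Integrable (fun x => |x|) μ) :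
    Integrable (fun q : ℝ × ℝ × ℝ => TT q.1 q.2.1 q.2.2) (μ.prod (μ.prod μ)) ∧
    ∫ q : ℝ × ℝ × ℝ, TT q.1 q.2.1 q.2.2 ∂(μ.prod (μ.prod μ)) =
      6 * ∫ q : ℝ × ℝ × ℝ, MM q.1 q.2.1 q.2.2 ∂(μ.prod (μ.prod μ)) := by
  have hM := MM_int μ h1
  have L := law3 μ 0 1 2 (by decide) (by decide) (by decide)
  have a1 := mp_int L hM
  have a2 := mp_int (law3 μ 0 2 1 (by decide) (by decide) (by decide)) hM
  have a3 := mp_int (law3 μ 1 0 2 (by decide) (by decide) (by decide)) hM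
  have a4 := mp_int (law3 μ 1 2 0 (by decide) (by decide) (by decide)) hM
  have a5 := mp_int (law3 μ 2 0 1 (by decide) (by decide) (by decide)) hM
  have a6 := mp_int (law3 μ 2 1 0 (by decide) (by decide) (by decide)) hM
  have hsm : AEStronglyMeasurable (fun q : ℝ × ℝ × ℝ => TT q.1 q.2.1 q.2.2) (μ.prod (μ.prod μ)) :=
    Measurable.aestronglyMeasurable (by unfold TT; fun_prop)
  have e : ∀ x : Fin 4 → ℝ, TT (x 0) (x 1) (x 2) = _ := fun x => TM_all (x 0) (x 1) (x 2)
  have i2 := a1.1.fun_add a2.1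
  have i3 := i2.fun_add a3.1
  have i4 := i3.fun_add a4.1
  have i5 := i4.fun_add a5.1
  have i6 := i5.fun_add a6.1
  have hI : Integrable (fun q : ℝ × ℝ × ℝ => TT q.1 q.2.1 q.2.2) (μ.prod (μ.prod μ)) := by
    rw [← L.integrable_comp hsm]
    refine i6.congr (Filter.Eventually.of_forall fun x => ?_)
    exact (e x).symm
  refine ⟨hI, ?_⟩
  rw [← (mp_int L hI).2]
  simp only
  simp_rw [e]
  rw [integral_add i5 a6.1, integral_add i4 a5.1, integral_add i3 a4.1, integral_add i2 a3.1,
    integral_add a1.1 a2.1, a1.2, a2.2, a3.2, a4.2, a5.2, a6.2]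
  ring

theorem main_sum (μ : Measure ℝ) [IsProbabilityMeasure μ] (h1 : Integrable (fun x => |x|) μ) :
    distVar μ = (∫ q, |q.1 - q.2| ∂(μ.prod μ)) ^ 2 -
      (4 / 3) * ∫ q : ℝ × ℝ × ℝ, TT q.1 q.2.1 q.2.2 ∂(μ.prod (μ.prod μ)) := by
  have hT := (TT_int μ h1).1
  have hD := distVar_DD μ h1
  have hA : Integrable (fun w : (ℝ × ℝ) × (ℝ × ℝ) => |w.1.1 - w.1.2| * |w.2.1 - w.2.2|)
      ((μ.prod μ).prod (μ.prod μ)) := (diff_int μ h1).mul_prod (diff_int μ h1)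
  have hAe : ∫ w : (ℝ × ℝ) × (ℝ × ℝ), |w.1.1 - w.1.2| * |w.2.1 - w.2.2| ∂((μ.prod μ).prod (μ.prod μ))
      = (∫ q, |q.1 - q.2| ∂(μ.prod μ)) ^ 2 := by
    rw [sq, integral_prod_mul (fun q : ℝ × ℝ => |q.1 - q.2|) (fun q : ℝ × ℝ => |q.1 - q.2|)]
  have L1 := law4 μ 0 1 2 3 (by decide) (by decide) (by decide) (by decide) (by decide) (by decide)
  have L2 := law4 μ 0 2 1 3 (by decide) (by decide) (by decide) (by decide) (by decide) (by decide)
  have L3 := law4 μ 0 3 1 2 (by decide) (by decide) (by decide) (by decide) (by decide) (by decide)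
  have d1 := mp_int L1 hD.1
  have d2 := mp_int L2 hD.1
  have d3 := mp_int L3 hD.1
  have a1 := mp_int L1 hA
  have a2 := mp_int L2 hA
  have a3 := mp_int L3 hA
  have t1 := mp_int (law3 μ 0 1 2 (by decide) (by decide) (by decide)) hT
  have t2 := mp_int (law3 μ 0 1 3 (by decide) (by decide) (by decide)) hT
  have t3 := mp_int (law3 μ 0 2 3 (by decide) (by decide) (by decide)) hT
  have t4 := mp_int (law3 μ 1 2 3 (by decide) (by decide) (by decide)) hT
  have key : ∀ x : Fin 4 → ℝ, _ = _ := fun x => Phi_all (x 0) (x 1) (x 2) (x 3)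
  have K := integral_congr_ae (μ := Measure.pi fun _ : Fin 4 => μ)
    (Filter.Eventually.of_forall key)
  simp only at d1 d2 d3 a1 a2 a3 t1 t2 t3 t4
  rw [integral_div, integral_add (d1.1.fun_add d2.1) d3.1, integral_add d1.1 d2.1,
    integral_sub ((a1.1.fun_add a2.1).fun_add a3.1) (((t1.1.fun_add t2.1).fun_add t3.1).fun_add t4.1),
    integral_add (a1.1.fun_add a2.1) a3.1, integral_add a1.1 a2.1,
    integral_add ((t1.1.fun_add t2.1).fun_add t3.1) t4.1, integral_add (t1.1.fun_add t2.1) t3.1,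
    integral_add t1.1 t2.1, d1.2, d2.2, d3.2, a1.2, a2.2, a3.2, t1.2, t2.2, t3.2, t4.2, hAe] at K
  rw [hD.2]
  linarith

theorem distVar_order_stat_rep (μ : Measure ℝ) [IsProbabilityMeasure μ]
    (h1 : Integrable (fun x => |x|) μ) :
    distVar μ =
        (∫ q, |q.1 - q.2| ∂(μ.prod μ)) ^ 2 -
          (4 / 3) * ∫ q : ℝ × ℝ × ℝ,
            ((q.1 + q.2.1 + q.2.2 - min q.1 (min q.2.1 q.2.2) - max q.1 (max q.2.1 q.2.2))
                - min q.1 (min q.2.1 q.2.2)) *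
              (max q.1 (max q.2.1 q.2.2)
                - (q.1 + q.2.1 + q.2.2 - min q.1 (min q.2.1 q.2.2)
                    - max q.1 (max q.2.1 q.2.2))) ∂(μ.prod (μ.prod μ)) ∧
      distVar μ =
        (∫ q, |q.1 - q.2| ∂(μ.prod μ)) ^ 2 -
          8 * ∫ q : ℝ × ℝ × ℝ,
            max (q.1 - q.2.1) 0 * max (q.2.2 - q.1) 0 ∂(μ.prod (μ.prod μ)) := by
  have h := main_sum μ h1
  have h6 := (TT_int μ h1).2
  refine ⟨h, ?_⟩
  rw [h, h6]
  unfold MM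
  ring
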